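/- The maximum cardinality of a tristance anticode of diameter d in the infinity graph on Z^2 equals ⌈(4d^2 + 8d + 2)/7⌉. -/

import Mathlib

/-- Grid tristance in `ℤ²` (bounding-box formula). -/
def tri (a b c : ℤ × ℤ) : ℤ :=
  (max a.1 (max b.1 c.1) - min a.1 (min b.1 c.1)) +
  (max a.2 (max b.2 c.2) - min a.2 (min b.2 c.2))

/-- The rotation-scaling map `φ(x,y) = (x−y, x+y)`. -/
def phi (z : ℤ × ℤ) : ℤ × ℤ := (z.1 - z.2, z.1 + z.2)

/-- Tristance in the infinity graph on `ℤ²`: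
`d₃*(z₁,z₂,z₃) = ⌈d₃(φ(z₁),φ(z₂),φ(z₃))/2⌉`. -/
noncomputable def triInf (z1 z2 z3 : ℤ × ℤ) : ℤ :=
  ⌈(tri (phi z1) (phi z2) (phi z3) : ℚ) / 2⌉

theorem triInf_le_iff (a b c : ℤ × ℤ) (d : ℤ) :
    triInf a b c ≤ d ↔ tri (phi a) (phi b) (phi c) ≤ 2 * d := by
  unfold triInf
  rw [Int.ceil_le, div_le_iff₀ (by norm_num)]
  constructor
  · intro h
    have h' : ((tri (phi a) (phi b) (phi c) : ℤ) : ℚ) ≤ ((d * 2 : ℤ) : ℚ) := by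
      push_cast
      exact h
    have := Int.cast_le.mp h'
    omega
  · intro h
    have h' : ((tri (phi a) (phi b) (phi c) : ℤ) : ℚ) ≤ ((2 * d : ℤ) : ℚ) := Int.cast_le.mpr h
    push_cast at h'
    linarith

/-- The `t (t + 1) / 2` lattice points at `ℓ¹`-distance less than `t` from `p` in the quadrant
with apex `p` and directions given by the signs `s` and `r`. -/
def cornerTriangle (p : ℤ × ℤ) (s r : ℤˣ) (t : ℕ) : Finset (ℤ × ℤ) :=
  ((Finset.range t).sigma fun i => Finset.range (i + 1)).image
    fun z => (p.1 + s * (z.2 : ℤ), p.2 + r * ((z.1 : ℤ) - z.2))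

theorem mem_cornerTriangle {p q : ℤ × ℤ} {s r : ℤˣ} {t : ℕ} :
    q ∈ cornerTriangle p s r t ↔
      0 ≤ s * (q.1 - p.1) ∧ 0 ≤ r * (q.2 - p.2) ∧ s * (q.1 - p.1) + r * (q.2 - p.2) < t := by
  obtain ⟨x, y⟩ := q
  simp only [cornerTriangle, Finset.mem_image, Finset.mem_sigma, Finset.mem_range, Prod.mk.injEq,
    Sigma.exists]
  constructor
  · rintro ⟨i, j, ⟨hi, hj⟩, rfl, rfl⟩
    rcases Int.units_eq_one_or s with rfl | rfl <;> rcases Int.units_eq_one_or r with rfl | rfl <;>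
      simp <;> omega
  · intro h
    refine ⟨(s * (x - p.1) + r * (y - p.2)).toNat, (s * (x - p.1)).toNat, ?_⟩
    rcases Int.units_eq_one_or s with rfl | rfl <;> rcases Int.units_eq_one_or r with rfl | rfl <;>
      simp at h ⊢ <;> omega

theorem two_mul_card_cornerTriangle (p : ℤ × ℤ) (s r : ℤˣ) (t : ℕ) :
    2 * (cornerTriangle p s r t).card = t * (t + 1) := by
  rw [cornerTriangle, Finset.card_image_of_injective, Finset.card_sigma]
  · simp only [Finset.card_range]
    induction t with
    | zero => simp
    | succ n ih =>
      rw [Finset.sum_range_succ, mul_add, ih]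
      ring
  · rintro ⟨i, j⟩ ⟨i', j'⟩ h
    simp only [Prod.mk.injEq] at h
    have hij : i = i' ∧ j = j' := by
      rcases Int.units_eq_one_or s with rfl | rfl <;>
        rcases Int.units_eq_one_or r with rfl | rfl <;> simp at h <;> omega
    obtain ⟨rfl, rfl⟩ := hij
    rfl

/-- The lattice box with lower left corner `p` and side lengths `X` and `Y`, with corner triangles
of sizes `a` (lower left), `b` (lower right), `c` (upper left) and `e` (upper right) removed. -/
noncomputable def octagon (p : ℤ × ℤ) (X Y a b c e : ℕ) : Finset (ℤ × ℤ) :=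
  (Finset.Icc p.1 (p.1 + X) ×ˢ Finset.Icc p.2 (p.2 + Y)).filter fun q =>
    (a : ℤ) ≤ (q.1 - p.1) + (q.2 - p.2) ∧ (b : ℤ) ≤ (p.1 + X - q.1) + (q.2 - p.2) ∧
    (c : ℤ) ≤ (q.1 - p.1) + (p.2 + Y - q.2) ∧ (e : ℤ) ≤ (p.1 + X - q.1) + (p.2 + Y - q.2)

theorem two_mul_card_octagon_add (p : ℤ × ℤ) {X Y a b c e : ℕ} (hab : a + b ≤ X) (hce : c + e ≤ X)
    (hac : a + c ≤ Y) (hbe : b + e ≤ Y) :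
    2 * (octagon p X Y a b c e).card + (a * (a + 1) + b * (b + 1) + c * (c + 1) + e * (e + 1)) =
      2 * ((X + 1) * (Y + 1)) := by
  have hbox : (Finset.Icc p.1 (p.1 + X) ×ˢ Finset.Icc p.2 (p.2 + Y)).card = (X + 1) * (Y + 1) := by
    rw [Finset.card_product, Int.card_Icc, Int.card_Icc]
    congr 1 <;> omega
  have hsplit : Finset.Icc p.1 (p.1 + X) ×ˢ Finset.Icc p.2 (p.2 + Y) =
      octagon p X Y a b c e ∪ (cornerTriangle p 1 1 a ∪ (cornerTriangle (p.1 + X, p.2) (-1) 1 b ∪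
        (cornerTriangle (p.1, p.2 + Y) 1 (-1) c ∪
          cornerTriangle (p.1 + X, p.2 + Y) (-1) (-1) e))) := by
    ext q
    simp only [octagon, Finset.mem_union, mem_cornerTriangle, Finset.mem_filter,
      Finset.mem_product, Finset.mem_Icc, Units.val_one, Units.val_neg]
    omega
  rw [← hbox, hsplit, Finset.card_union_of_disjoint, Finset.card_union_of_disjoint,
    Finset.card_union_of_disjoint, Finset.card_union_of_disjoint]
  · simp only [mul_add 2, two_mul_card_cornerTriangle]
    ring
  all_goals
    rw [Finset.disjoint_left]
    intro q
    simp only [octagon, Finset.mem_union, mem_cornerTriangle, Finset.mem_filter,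
      Finset.mem_product, Finset.mem_Icc, Units.val_one, Units.val_neg]
    omega

theorem sub_add_sub_le_tri {a b c i j k l : ℤ × ℤ} (hi : i = a ∨ i = b ∨ i = c)
    (hj : j = a ∨ j = b ∨ j = c) (hk : k = a ∨ k = b ∨ k = c) (hl : l = a ∨ l = b ∨ l = c) :
    (i.1 - j.1) + (k.2 - l.2) ≤ tri a b c := by
  have hi' : i.1 ≤ max a.1 (max b.1 c.1) := by rcases hi with rfl | rfl | rfl <;> simp
  have hj' : min a.1 (min b.1 c.1) ≤ j.1 := by rcases hj with rfl | rfl | rfl <;> simp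
  have hk' : k.2 ≤ max a.2 (max b.2 c.2) := by rcases hk with rfl | rfl | rfl <;> simp
  have hl' : min a.2 (min b.2 c.2) ≤ l.2 := by rcases hl with rfl | rfl | rfl <;> simp
  unfold tri
  linarith

theorem exists_max_three_eq (f : ℤ × ℤ → ℤ) (a b c : ℤ × ℤ) :
    ∃ i, (i = a ∨ i = b ∨ i = c) ∧ max (f a) (max (f b) (f c)) = f i := by
  rcases max_choice (f b) (f c) with h | h <;> rw [h]
  · rcases max_choice (f a) (f b) with h' | h' <;> rw [h']
    exacts [⟨a, by simp⟩, ⟨b, by simp⟩]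
  · rcases max_choice (f a) (f c) with h' | h' <;> rw [h']
    exacts [⟨a, by simp⟩, ⟨c, by simp⟩]

theorem exists_min_three_eq (f : ℤ × ℤ → ℤ) (a b c : ℤ × ℤ) :
    ∃ i, (i = a ∨ i = b ∨ i = c) ∧ min (f a) (min (f b) (f c)) = f i := by
  obtain ⟨i, hi, h⟩ := exists_max_three_eq (fun z => -f z) a b c
  refine ⟨i, hi, ?_⟩
  rw [max_neg_neg, max_neg_neg] at h
  exact neg_inj.mp h

/-- Three points attain the four extremes, so one of them attains two. -/
theorem exists_tri_eq (a b c : ℤ × ℤ) :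
    ∃ i j k l : ℤ × ℤ, (i = a ∨ i = b ∨ i = c) ∧ (j = a ∨ j = b ∨ j = c) ∧
      (k = a ∨ k = b ∨ k = c) ∧ (l = a ∨ l = b ∨ l = c) ∧
      (i = j ∨ i = k ∨ i = l ∨ j = k ∨ j = l ∨ k = l) ∧
      tri a b c = (i.1 - j.1) + (k.2 - l.2) := by
  obtain ⟨i, hi, hi'⟩ := exists_max_three_eq Prod.fst a b c
  obtain ⟨j, hj, hj'⟩ := exists_min_three_eq Prod.fst a b c
  obtain ⟨k, hk, hk'⟩ := exists_max_three_eq Prod.snd a b c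
  obtain ⟨l, hl, hl'⟩ := exists_min_three_eq Prod.snd a b c
  refine ⟨i, j, k, l, hi, hj, hk, hl, ?_, ?_⟩
  · clear hi' hj' hk' hl'
    grind
  · rw [tri, hi', hj', hk', hl']

theorem tri_phi_le_of_mem_octagon {p : ℤ × ℤ} {X a b d : ℕ} (h : 3 * X ≤ a + b + 2 * d)
    (hX : X ≤ d)
    {z w v : ℤ × ℤ} (hz : z ∈ octagon p X X a b b a) (hw : w ∈ octagon p X X a b b a)
    (hv : v ∈ octagon p X X a b b a) : tri (phi z) (phi w) (phi v) ≤ 2 * d := by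
  have hmem : ∀ i, (i = phi z ∨ i = phi w ∨ i = phi v) →
      ∃ q ∈ octagon p X X a b b a, i = phi q := by
    rintro i (rfl | rfl | rfl)
    exacts [⟨z, hz, rfl⟩, ⟨w, hw, rfl⟩, ⟨v, hv, rfl⟩]
  obtain ⟨i, j, k, l, hi, hj, hk, hl, heq, htri⟩ := exists_tri_eq (phi z) (phi w) (phi v)
  obtain ⟨i, hi', rfl⟩ := hmem i hi
  obtain ⟨j, hj', rfl⟩ := hmem j hj
  obtain ⟨k, hk', rfl⟩ := hmem k hk
  obtain ⟨l, hl', rfl⟩ := hmem l hl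
  rw [htri]
  simp only [octagon, Finset.mem_filter, Finset.mem_product, Finset.mem_Icc] at hi' hj' hk' hl'
  simp only [phi, Prod.mk.injEq] at heq ⊢
  clear htri hz hw hv hmem hi hj hk hl
  rcases heq with heq | heq | heq | heq | heq | heq <;> omega

theorem seven_mul_le_of_octagon_bound {n X Y d a b c e : ℤ} (hX : 0 ≤ X) (hY : 0 ≤ Y)
    (ha : 0 ≤ a) (hb : 0 ≤ b) (hc : 0 ≤ c) (he : 0 ≤ e)
    (hd : 3 * (X + Y) ≤ 4 * d + (a + b + c + e))
    (hn : 2 * n + (a * (a + 1) + b * (b + 1) + c * (c + 1) + e * (e + 1)) ≤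
      2 * ((X + 1) * (Y + 1))) :
    7 * n ≤ 4 * d ^ 2 + 8 * d + 7 := by
  obtain ⟨S, hS⟩ : ∃ S, S = X + Y := ⟨_, rfl⟩
  obtain ⟨σ, hσ⟩ : ∃ σ, σ = a + b + c + e := ⟨_, rfl⟩
  have hprod : 4 * ((X + 1) * (Y + 1)) ≤ (S + 2) ^ 2 := by
    subst hS
    nlinarith [sq_nonneg (X - Y)]
  have hsq : σ ^ 2 ≤ 4 * (a ^ 2 + b ^ 2 + c ^ 2 + e ^ 2) := by
    subst hσ
    nlinarith [sq_nonneg (a - b), sq_nonneg (a - c), sq_nonneg (a - e), sq_nonneg (b - c),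
      sq_nonneg (b - e), sq_nonneg (c - e)]
  have hcount : 8 * n + σ ^ 2 + 4 * σ ≤ 2 * (S + 2) ^ 2 := by nlinarith
  rw [← hS, ← hσ] at hd
  have hσ0 : 0 ≤ σ := by omega
  have hS0 : 0 ≤ S := by omega
  rcases le_total (4 * d) (3 * S) with h | h
  · have hmono : (3 * S - 4 * d) ^ 2 ≤ σ ^ 2 := pow_le_pow_left₀ (by omega) (by omega) 2
    have : 2 * (7 * n) ≤ 2 * (4 * d ^ 2 + 8 * d + 7) + 1 := by
      nlinarith [sq_nonneg (7 * S - 12 * d + 2)]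
    omega
  · have hd0 : 0 ≤ d := by omega
    have hn4 : 4 * n ≤ (S + 2) ^ 2 := by nlinarith
    rcases le_or_gt 3 d with h3 | h3
    · have : (3 * (S + 2)) ^ 2 ≤ (4 * d + 6) ^ 2 := pow_le_pow_left₀ (by omega) (by omega) 2
      nlinarith
    · interval_cases d
      · obtain rfl : S = 0 := by omega
        omega
      · have : S ≤ 1 := by omega
        interval_cases S <;> omega
      · have : S ≤ 2 := by omega
        interval_cases S <;> omega

theorem seven_mul_card_le_of_anticode {d : ℕ} {A : Finset (ℤ × ℤ)}
    (hA : ∀ z1 ∈ A, ∀ z2 ∈ A, ∀ z3 ∈ A, triInf z1 z2 z3 ≤ (d : ℤ)) :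
    7 * A.card ≤ 4 * d ^ 2 + 8 * d + 7 := by
  rcases A.eq_empty_or_nonempty with rfl | hne
  · simp
  simp only [triInf_le_iff] at hA
  obtain ⟨l, hl, hl'⟩ := A.exists_min_image (fun z => z.1) hne
  obtain ⟨r, hr, hr'⟩ := A.exists_max_image (fun z => z.1) hne
  obtain ⟨m, hm, hm'⟩ := A.exists_min_image (fun z => z.2) hne
  obtain ⟨t, ht, ht'⟩ := A.exists_max_image (fun z => z.2) hne
  obtain ⟨lm, hlm, hlm'⟩ := A.exists_min_image (fun z => z.1 + z.2) hne
  obtain ⟨rt, hrt, hrt'⟩ := A.exists_max_image (fun z => z.1 + z.2) hne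
  obtain ⟨lt, hlt, hlt'⟩ := A.exists_min_image (fun z => z.1 - z.2) hne
  obtain ⟨rm, hrm, hrm'⟩ := A.exists_max_image (fun z => z.1 - z.2) hne
  obtain ⟨X, hX⟩ : ∃ X : ℕ, (X : ℤ) = r.1 - l.1 :=
    ⟨(r.1 - l.1).toNat, by have := hl' r hr; omega⟩
  obtain ⟨Y, hY⟩ : ∃ Y : ℕ, (Y : ℤ) = t.2 - m.2 :=
    ⟨(t.2 - m.2).toNat, by have := hm' t ht; omega⟩
  obtain ⟨a, ha⟩ : ∃ a : ℕ, (a : ℤ) = lm.1 + lm.2 - l.1 - m.2 :=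
    ⟨(lm.1 + lm.2 - l.1 - m.2).toNat, by have := hl' lm hlm; have := hm' lm hlm; omega⟩
  obtain ⟨b, hb⟩ : ∃ b : ℕ, (b : ℤ) = r.1 - m.2 - (rm.1 - rm.2) :=
    ⟨(r.1 - m.2 - (rm.1 - rm.2)).toNat, by have := hr' rm hrm; have := hm' rm hrm; omega⟩
  obtain ⟨c, hc⟩ : ∃ c : ℕ, (c : ℤ) = lt.1 - lt.2 - l.1 + t.2 :=
    ⟨(lt.1 - lt.2 - l.1 + t.2).toNat, by have := hl' lt hlt; have := ht' lt hlt; omega⟩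
  obtain ⟨e, he⟩ : ∃ e : ℕ, (e : ℤ) = r.1 + t.2 - (rt.1 + rt.2) :=
    ⟨(r.1 + t.2 - (rt.1 + rt.2)).toNat, by have := hr' rt hrt; have := ht' rt hrt; omega⟩
  have hab : a + b ≤ X := by have := hlm' m hm; have := hrm' m hm; omega
  have hce : c + e ≤ X := by have := hlt' t ht; have := hrt' t ht; omega
  have hac : a + c ≤ Y := by have := hlm' l hl; have := hlt' l hl; omega
  have hbe : b + e ≤ Y := by have := hrm' r hr; have := hrt' r hr; omega
  have hsub : A ⊆ octagon (l.1, m.2) X Y a b c e := by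
    intro q hq
    have := hl' q hq
    have := hr' q hq
    have := hm' q hq
    have := ht' q hq
    have := hlm' q hq
    have := hrt' q hq
    have := hlt' q hq
    have := hrm' q hq
    simp only [octagon, Finset.mem_filter, Finset.mem_product, Finset.mem_Icc]
    omega
  have hcard := Finset.card_le_card hsub
  have hoct := two_mul_card_octagon_add (l.1, m.2) hab hce hac hbe
  have hbound : 2 * A.card + (a * (a + 1) + b * (b + 1) + c * (c + 1) + e * (e + 1)) ≤
      2 * ((X + 1) * (Y + 1)) := by omega
  have hr1 : 2 * r.1 - (lt.1 - lt.2) - (lm.1 + lm.2) ≤ 2 * d := by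
    have h := (sub_add_sub_le_tri (i := phi r) (j := phi lt) (k := phi r) (l := phi lm)
      (by simp) (by simp) (by simp) (by simp)).trans (hA r hr lt hlt lm hlm)
    simp only [phi] at h
    linarith
  have hl1 : (rm.1 - rm.2) + (rt.1 + rt.2) - 2 * l.1 ≤ 2 * d := by
    have h := (sub_add_sub_le_tri (i := phi rm) (j := phi l) (k := phi rt) (l := phi l)
      (by simp) (by simp) (by simp) (by simp)).trans (hA l hl rm hrm rt hrt)
    simp only [phi] at h
    linarith
  have ht1 : 2 * t.2 + (rm.1 - rm.2) - (lm.1 + lm.2) ≤ 2 * d := by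
    have h := (sub_add_sub_le_tri (i := phi rm) (j := phi t) (k := phi t) (l := phi lm)
      (by simp) (by simp) (by simp) (by simp)).trans (hA t ht rm hrm lm hlm)
    simp only [phi] at h
    linarith
  have hm1 : (rt.1 + rt.2) - (lt.1 - lt.2) - 2 * m.2 ≤ 2 * d := by
    have h := (sub_add_sub_le_tri (i := phi m) (j := phi lt) (k := phi rt) (l := phi m)
      (by simp) (by simp) (by simp) (by simp)).trans (hA m hm lt hlt rt hrt)
    simp only [phi] at h
    linarith
  have key := seven_mul_le_of_octagon_bound (n := A.card) (X := X) (Y := Y) (d := d) (a := a)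
    (b := b) (c := c) (e := e) (by omega) (by omega) (by omega) (by omega) (by omega) (by omega)
    (by omega) (by exact_mod_cast hbound)
  exact_mod_cast key

/-- An octagon inscribed in a square of side `⌊(6d + 2)/7⌋` is an anticode of the optimal size. -/
theorem exists_large_anticode (d : ℕ) : ∃ A : Finset (ℤ × ℤ),
    (∀ z1 ∈ A, ∀ z2 ∈ A, ∀ z3 ∈ A, triInf z1 z2 z3 ≤ (d : ℤ)) ∧
      4 * d ^ 2 + 8 * d + 1 ≤ 7 * A.card := by
  obtain ⟨X, hX⟩ : ∃ X, X = (6 * d + 2) / 7 := ⟨_, rfl⟩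
  obtain ⟨a, ha⟩ : ∃ a, a = (3 * X - 2 * d + 1) / 2 := ⟨_, rfl⟩
  obtain ⟨b, hb⟩ : ∃ b, b = (3 * X - 2 * d) / 2 := ⟨_, rfl⟩
  have hXd : X ≤ d := by omega
  have hle : 2 * d ≤ 3 * X := by
    rcases le_or_gt 2 d with h | h
    · omega
    · interval_cases d <;> omega
  have hτ : a + b + 2 * d = 3 * X := by omega
  refine ⟨octagon 0 X X a b b a, fun z1 h1 z2 h2 z3 h3 => ?_, ?_⟩
  · rw [triInf_le_iff]
    exact tri_phi_le_of_mem_octagon hτ.ge hXd h1 h2 h3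
  have hoct := two_mul_card_octagon_add 0 (X := X) (Y := X) (a := a) (b := b) (c := b) (e := a)
    (by omega) (by omega) (by omega) (by omega)
  generalize (octagon 0 X X a b b a).card = n at hoct ⊢
  obtain ⟨k, hk⟩ : ∃ k : ℤ, k = 7 * X - 6 * d + 1 := ⟨_, rfl⟩
  obtain ⟨j, hj⟩ : ∃ j : ℤ, j = a - b := ⟨_, rfl⟩
  have hsmall : k ^ 2 + 7 * j ^ 2 ≤ 11 := by
    have hk1 : -3 ≤ k := by omega
    have hk2 : k ≤ 3 := by omega
    have hcase : j = 0 ∧ k ≠ 0 ∨ j = 1 ∧ k ≠ 3 ∧ k ≠ -3 := by omega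
    rcases hcase with ⟨rfl, -⟩ | ⟨rfl, h3, h3'⟩
    · nlinarith
    · have : -2 ≤ k := by omega
      have : k ≤ 2 := by omega
      nlinarith
  have hτ' : (a : ℤ) + b = 3 * X - 2 * d := by omega
  have hexact : 14 * (n : ℤ) = 2 * (4 * d ^ 2 + 8 * d) + 15 - k ^ 2 - 7 * j ^ 2 := by
    have hoct' : 2 * (n : ℤ) + (a * (a + 1) + b * (b + 1) + b * (b + 1) + a * (a + 1)) =
        2 * ((X + 1) * (X + 1)) := by exact_mod_cast hoct
    obtain rfl : k = 7 * X - 6 * d + 1 := hk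
    have ha' : (b : ℤ) = 3 * X - 2 * d - a := by omega
    rw [ha'] at hoct' hj
    subst hj
    linear_combination 7 * hoct'
  zify
  linarith

/-- The maximum cardinality of a tristance anticode of diameter `d` in the
infinity graph equals `⌈(4d² + 8d + 2)/7⌉` (ceiling division). -/
theorem optimal_inf_tristance_anticode_card (d : ℕ) :
    IsGreatest
      {n : ℕ | ∃ A : Finset (ℤ × ℤ),
        (∀ z1 ∈ A, ∀ z2 ∈ A, ∀ z3 ∈ A, triInf z1 z2 z3 ≤ (d : ℤ)) ∧ A.card = n}
      ((4 * d ^ 2 + 8 * d + 2 + 6) / 7) := by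
  have hmod : (4 * d ^ 2 + 8 * d + 2 + 6) % 7 ≠ 0 := by
    have hd : d % 7 = 0 ∨ d % 7 = 1 ∨ d % 7 = 2 ∨ d % 7 = 3 ∨ d % 7 = 4 ∨ d % 7 = 5 ∨
        d % 7 = 6 := by omega
    rcases hd with h | h | h | h | h | h | h <;>
      simp [Nat.add_mod, Nat.mul_mod, Nat.pow_mod, h]
  constructor
  · obtain ⟨A, hA, hcard⟩ := exists_large_anticode d
    have hupper := seven_mul_card_le_of_anticode hA
    exact ⟨A, hA, by omega⟩
  · rintro n ⟨A, hA, rfl⟩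
    have hupper := seven_mul_card_le_of_anticode hA
    omega
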